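/- Let P be a program, M ⊆ at(P), P' = ⋃_{x ∈ M} (P_x^M ∪ {{x_x} ← ∅} ∪ {{y_x} ← ∅ : y ∈ at(P) \ M}), and M_P = M ∪ {x̄ : x ∈ at(P) \ M}. Then M ∈ AS(P) if and only if for every inclusion-minimal model N of P', M_P ∪ N ∈ AS(P_trans). Moreover, every answer set of P_trans is of the form M_P ∪ N for some M ⊆ at(P) and some inclusion-minimal model N of the corresponding program P'. -/

import Mathlib

open Classical

noncomputable section

/-- A rule of a disjunctive logic program: head, positive body, negative body. -/
structure Rule (A : Type*) where
  head : Finset A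
  bodyP : Finset A
  bodyN : Finset A
  deriving DecidableEq

/-- A program is a finite set of rules. -/
abbrev Program (A : Type*) := Finset (Rule A)

variable {A : Type*} [DecidableEq A]

/-- The atoms occurring in a program. -/
def atoms (P : Program A) : Finset A := P.sup (fun r => r.head ∪ r.bodyP ∪ r.bodyN)

/-- An interpretation `I` satisfies a rule `r` iff `(H(r) ∪ B⁻(r)) ∩ I ≠ ∅` or `B⁺(r) \ I ≠ ∅`. -/
def satR (I : Set A) (r : Rule A) : Prop :=
  (∃ a ∈ r.head ∪ r.bodyN, a ∈ I) ∨ (∃ a ∈ r.bodyP, a ∉ I)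

/-- `I` is a model of `P` iff it satisfies every rule of `P`. -/
def isModel (I : Set A) (P : Program A) : Prop := ∀ r ∈ P, satR I r

/-- The Gelfond-Lifschitz reduct `P^I`. -/
def reduct (P : Program A) (I : Set A) : Program A :=
  (P.filter (fun r => ∀ a ∈ r.bodyN, a ∉ I)).image (fun r => ⟨r.head, r.bodyP, ∅⟩)

/-- `I` is an inclusion-minimal model of `P`. -/
def isMinModel (I : Set A) (P : Program A) : Prop :=
  isModel I P ∧ ∀ J ⊆ I, isModel J P → J = I

/-- `I` is an answer set of `P` iff `I` is a minimal model of the reduct `P^I`. -/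
def isAnswerSet (I : Set A) (P : Program A) : Prop := isMinModel I (reduct P I)

/-- The collection of answer sets of `P`. -/
def AS (P : Program A) : Set (Set A) := {M | isAnswerSet M P}

/-- Dual-Horn: every rule has at most one positive body atom and empty negative body. -/
def dualHorn (P : Program A) : Prop := ∀ r ∈ P, r.bodyP.card ≤ 1 ∧ r.bodyN = ∅

/-- Dual-normal: every rule is a constraint or has at most one positive body atom. -/
def dualNormal (P : Program A) : Prop := ∀ r ∈ P, r.head = ∅ ∨ r.bodyP.card ≤ 1

/-- Normal: every rule has at most one head atom. -/
def normal (P : Program A) : Prop := ∀ r ∈ P, r.head.card ≤ 1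

/-- The proper rules (non-constraints) of `P`. -/
def properPart (P : Program A) : Program A := P.filter (fun r => r.head ≠ ∅)

/-- The constraints of `P`. -/
def constraintPart (P : Program A) : Program A := P.filter (fun r => r.head = ∅)

/-- `P[t]`: replace each rule with empty positive body by one whose positive body is `{t}`. -/
def progT (P : Program A) (t : A) : Program A :=
  P.image (fun r => if r.bodyP = ∅ then ⟨r.head, {t}, r.bodyN⟩ else r)

/-- The elimination sets `E_i` computed from `P[t]` (for `P` dual-Horn). -/
def E (P : Program A) (t : A) : ℕ → Set A
  | 0 => ∅
  | (i+1) => {b | ∃ r ∈ progT P t, r.bodyP = {b} ∧ ↑r.head ⊆ E P t i}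

/-- The program `P_{M,m}`. -/
def pmm (P : Program A) (M : Set A) (m : A) : Program A :=
  reduct (properPart P) M ∪
    ((atoms P).filter (fun b => b ∉ M)).image (fun b => ⟨∅, {b}, ∅⟩) ∪
    {⟨∅, {m}, ∅⟩}

/- Atoms of the translated program: `Sum.inl a` is the original atom `a`,
`Sum.inr (Sum.inl x)` is the fresh atom `x̄`, and `Sum.inr (Sum.inr (y?, x))` is the fresh
atom `y_x` (with `y? = some y`) resp. `t_x` (with `y? = none`). -/
abbrev TA (A : Type*) := A ⊕ (A ⊕ (Option A × A))

/-- The original atom `a`. -/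
def orig (a : A) : TA A := Sum.inl a

/-- The fresh atom `x̄`. -/
def bar (x : A) : TA A := Sum.inr (Sum.inl x)

/-- The fresh atom `y_x` (`sub (some y) x`) resp. `t_x` (`sub none x`). -/
def sub (y : Option A) (x : A) : TA A := Sum.inr (Sum.inr (y, x))

/-- The program `P_x = { B⁺(r)_x ← H(r)_x, not B⁻(r) : r ∈ (P_r)[t] }`:
heads and positive bodies of the rules of `(P_r)[t]` are swapped and their atoms renamed
with subscript `x`; negative bodies keep the original atoms. -/
def Px (P : Program A) (x : A) : Program (TA A) :=
  (properPart P).image (fun r =>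
    ⟨if r.bodyP = ∅ then {sub none x} else r.bodyP.image (fun y => sub (some y) x),
     r.head.image (fun y => sub (some y) x),
     r.bodyN.image orig⟩)

/-- `P_xor = { {x} ← ∅, not {x̄} ; {x̄} ← ∅, not {x} : x ∈ at(P) }`. -/
def Pxor (P : Program A) : Program (TA A) :=
  (atoms P).image (fun x => ⟨{orig x}, ∅, {bar x}⟩) ∪
  (atoms P).image (fun x => ⟨{bar x}, ∅, {orig x}⟩)

/-- `P_aux = { {x_x} ← ∅, not {x̄} : x ∈ at(P) } ∪ { {y_x} ← ∅, not {x̄, y} : x, y ∈ at(P) }`. -/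
def Paux (P : Program A) : Program (TA A) :=
  (atoms P).image (fun x => ⟨{sub (some x) x}, ∅, {bar x}⟩) ∪
  ((atoms P) ×ˢ (atoms P)).image (fun p => ⟨{sub (some p.2) p.1}, ∅, {bar p.1, orig p.2}⟩)

/-- `P_diag = P_xor ∪ P_aux ∪ ⋃_{x ∈ at(P)} P_x`. -/
def Pdiag (P : Program A) : Program (TA A) :=
  Pxor P ∪ Paux P ∪ (atoms P).biUnion (fun x => Px P x)

/-- `P_mod = { ∅ ← B⁺(r), not (H(r) ∪ B⁻(r)) : r ∈ P }`. -/
def Pmod (P : Program A) : Program (TA A) :=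
  P.image (fun r => ⟨∅, r.bodyP.image orig, (r.head ∪ r.bodyN).image orig⟩)

/-- `P_true = { ∅ ← {x}, not {t_x} : x ∈ at(P) }`. -/
def Ptrue (P : Program A) : Program (TA A) :=
  (atoms P).image (fun x => ⟨∅, {orig x}, {sub none x}⟩)

/-- The translated program `P_trans = P_diag ∪ P_mod ∪ P_true`. -/
def Ptrans (P : Program A) : Program (TA A) := Pdiag P ∪ Pmod P ∪ Ptrue P

/-- The program `P_x^M ∪ {{x_x} ← ∅} ∪ {{y_x} ← ∅ : y ∈ at(P) \ M}`, where the reduct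
of `P_x` is taken relative to `M` (whose atoms are original atoms). -/
def PxM (P : Program A) (M : Set A) (x : A) : Program (TA A) :=
  reduct (Px P x) (orig '' M) ∪ {⟨{sub (some x) x}, ∅, ∅⟩} ∪
    ((atoms P).filter (fun y => y ∉ M)).image (fun y => ⟨{sub (some y) x}, ∅, ∅⟩)

/-- `P' = ⋃_{x ∈ M} (P_x^M ∪ {{x_x} ← ∅} ∪ {{y_x} ← ∅ : y ∈ at(P) \ M})`. -/
def Pprime (P : Program A) (M : Set A) : Program (TA A) :=
  ((atoms P).filter (fun x => x ∈ M)).biUnion (fun x => PxM P M x)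

/-- `M_P = M ∪ {x̄ : x ∈ at(P) \ M}`. -/
def MPset (P : Program A) (M : Set A) : Set (TA A) :=
  orig '' M ∪ bar '' ((↑(atoms P) : Set A) \ M)

theorem isModel_reduct_iff {B : Type*} [DecidableEq B] (Q : Program B) (S I : Set B) :
    isModel I (reduct Q S) ↔ ∀ r ∈ Q, (∀ a ∈ r.bodyN, a ∉ S) →
      (∃ a ∈ r.head, a ∈ I) ∨ (∃ a ∈ r.bodyP, a ∉ I) := by
  unfold isModel reduct satR
  constructor
  · intro h r hr hN
    have := h ⟨r.head, r.bodyP, ∅⟩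
      (Finset.mem_image.2 ⟨r, Finset.mem_filter.2 ⟨hr, hN⟩, rfl⟩)
    simpa using this
  · intro h r' hr'
    obtain ⟨r, hr, rfl⟩ := Finset.mem_image.1 hr'
    obtain ⟨hr, hN⟩ := Finset.mem_filter.1 hr
    simpa using h r hr hN

theorem isModel_union_iff {B : Type*} [DecidableEq B] (Q R : Program B) (I : Set B) :
    isModel I (Q ∪ R) ↔ isModel I Q ∧ isModel I R := by
  unfold isModel
  constructor
  · intro h
    exact ⟨fun r hr => h r (Finset.mem_union_left _ hr),
      fun r hr => h r (Finset.mem_union_right _ hr)⟩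
  · rintro ⟨h1, h2⟩ r hr
    rcases Finset.mem_union.1 hr with h | h
    exacts [h1 r h, h2 r h]

theorem mem_atoms_of {B : Type*} [DecidableEq B] {Q : Program B} {r : Rule B} (hr : r ∈ Q)
    {a : B} (ha : a ∈ r.head ∪ r.bodyP ∪ r.bodyN) : a ∈ atoms Q := by
  unfold atoms
  exact Finset.mem_sup.2 ⟨r, hr, ha⟩

theorem exists_min_model {B : Type*} [DecidableEq B] (Q : Program B) (I : Set B)
    (h : isModel I Q) : ∃ N ⊆ I, isMinModel N Q := by
  have h1 : isModel (I ∩ ↑(atoms Q)) Q := by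
    intro r hr
    rcases h r hr with ⟨a, ha, haI⟩ | ⟨a, ha, haI⟩
    · refine Or.inl ⟨a, ha, haI, ?_⟩
      apply mem_atoms_of hr
      simp only [Finset.mem_union] at ha ⊢
      tauto
    · exact Or.inr ⟨a, ha, fun h => haI h.1⟩
  have hfin : ({J | J ⊆ I ∩ ↑(atoms Q) ∧ isModel J Q} : Set (Set B)).Finite :=
    Set.Finite.subset ((Set.toFinite ((↑(atoms Q) : Set B))).finite_subsets)
      (fun J hJ => hJ.1.trans Set.inter_subset_right)
  obtain ⟨N, hN1, hN2⟩ := hfin.isPWO.exists_le_minimal ⟨subset_rfl, h1⟩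
  refine ⟨N, fun a ha => (hN1 ha).1, hN2.prop.2, fun J hJ hJm => ?_⟩
  exact Set.Subset.antisymm hJ (hN2.le_of_le ⟨fun a ha => hN1 (hJ ha), hJm⟩ hJ)

/-- Satisfaction of the swapped rule with subscript `x`. -/
def RX (r : Rule A) (x : A) (I : Set (TA A)) : Prop :=
  (r.bodyP = ∅ ∧ sub none x ∈ I) ∨ (∃ y ∈ r.bodyP, sub (some y) x ∈ I) ∨
    ∃ y ∈ r.head, sub (some y) x ∉ I

theorem Px_reduct_iff (P : Program A) (x : A) (S I : Set (TA A)) :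
    isModel I (reduct (Px P x) S) ↔ ∀ r ∈ P, r.head ≠ ∅ → (∀ a ∈ r.bodyN, orig a ∉ S) →
      RX r x I := by
  rw [isModel_reduct_iff]
  have key : ∀ r : Rule A, ((∃ a ∈ (if r.bodyP = ∅ then ({sub none x} : Finset (TA A))
      else r.bodyP.image (fun y => sub (some y) x)), a ∈ I) ∨
      (∃ a ∈ r.head.image (fun y => sub (some y) x), a ∉ I)) ↔ RX r x I := by
    intro r
    unfold RX
    split_ifs with h <;> simp [h]
  unfold Px properPart
  constructor
  · intro h r hr hh hN
    have := h _ (Finset.mem_image.2 ⟨r, Finset.mem_filter.2 ⟨hr, hh⟩, rfl⟩) (by simpa using hN)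
    exact (key r).1 this
  · intro h r' hr' hN
    obtain ⟨r, hr, rfl⟩ := Finset.mem_image.1 hr'
    obtain ⟨hr, hh⟩ := Finset.mem_filter.1 hr
    exact (key r).2 (h r hr hh (by simpa using hN))

theorem Pprime_iff (P : Program A) (M : Set A) (I : Set (TA A)) :
    isModel I (Pprime P M) ↔ ∀ x ∈ atoms P, x ∈ M →
      (∀ r ∈ P, r.head ≠ ∅ → (∀ a ∈ r.bodyN, a ∉ M) → RX r x I) ∧
      sub (some x) x ∈ I ∧ ∀ y ∈ atoms P, y ∉ M → sub (some y) x ∈ I := by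
  have h1 : isModel I (Pprime P M) ↔ ∀ x ∈ atoms P, x ∈ M → isModel I (PxM P M x) := by
    unfold isModel Pprime
    constructor
    · intro h x hx hxM r hr
      exact h r (Finset.mem_biUnion.2 ⟨x, Finset.mem_filter.2 ⟨hx, hxM⟩, hr⟩)
    · intro h r hr
      obtain ⟨x, hx, hr⟩ := Finset.mem_biUnion.1 hr
      obtain ⟨hx, hxM⟩ := Finset.mem_filter.1 hx
      exact h x hx hxM r hr
  rw [h1]
  refine forall_congr' fun x => forall_congr' fun _ => forall_congr' fun _ => ?_
  unfold PxM
  rw [isModel_union_iff, isModel_union_iff, Px_reduct_iff, and_assoc]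
  refine and_congr ?_ (and_congr ?_ ?_)
  · simp [orig]
  · simp [isModel, satR, -Sum.exists, -Prod.exists]
  · unfold isModel satR
    rw [Finset.forall_mem_image]
    simp [-Sum.exists, -Prod.exists]

/-- The conditions for `I` to be a model of the reduct of the translated program. -/
theorem Ptrans_iff (P : Program A) (S I : Set (TA A)) :
    isModel I (reduct (Ptrans P) S) ↔
      (∀ x ∈ atoms P, bar x ∉ S → orig x ∈ I) ∧
      (∀ x ∈ atoms P, orig x ∉ S → bar x ∈ I) ∧
      (∀ x ∈ atoms P, bar x ∉ S → sub (some x) x ∈ I) ∧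
      (∀ x ∈ atoms P, ∀ y ∈ atoms P, bar x ∉ S → orig y ∉ S → sub (some y) x ∈ I) ∧
      (∀ x ∈ atoms P, ∀ r ∈ P, r.head ≠ ∅ → (∀ a ∈ r.bodyN, orig a ∉ S) → RX r x I) ∧
      (∀ r ∈ P, (∀ a ∈ r.head ∪ r.bodyN, orig a ∉ S) → ∃ a ∈ r.bodyP, orig a ∉ I) ∧
      (∀ x ∈ atoms P, sub none x ∉ S → orig x ∉ I) := by
  have hX : (∀ r ∈ (atoms P).biUnion (fun x => Px P x), (∀ a ∈ r.bodyN, a ∉ S) →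
      (∃ a ∈ r.head, a ∈ I) ∨ (∃ a ∈ r.bodyP, a ∉ I)) ↔
      (∀ x ∈ atoms P, ∀ r ∈ P, r.head ≠ ∅ → (∀ a ∈ r.bodyN, orig a ∉ S) → RX r x I) := by
    constructor
    · intro h x hx
      rw [← Px_reduct_iff, isModel_reduct_iff]
      exact fun r hr => h r (Finset.mem_biUnion.2 ⟨x, hx, hr⟩)
    · intro h r hr
      obtain ⟨x, hx, hr⟩ := Finset.mem_biUnion.1 hr
      have := h x hx
      rw [← Px_reduct_iff, isModel_reduct_iff] at this
      exact this r hr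
  rw [isModel_reduct_iff, ← hX]
  simp only [Ptrans, Pdiag, Pxor, Paux, Pmod, Ptrue]
  simp only [Finset.mem_union, or_imp, forall_and, and_assoc]
  simp only [Finset.forall_mem_image]
  refine and_congr ?_ (and_congr ?_ (and_congr ?_ (and_congr ?_ (and_congr Iff.rfl
    (and_congr ?_ ?_)))))
  · simp
  · simp
  · simp
  · simp only [Finset.mem_product, Prod.forall]
    simp
    grind
  · simp
    grind
  · simp

theorem orig_mem (P : Program A) (M : Set A) (N : Set (TA A))
    (hN : ∀ a ∈ N, ∃ o, ∃ x ∈ M, a = sub o x) (a : A) :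
    orig a ∈ MPset P M ∪ N ↔ a ∈ M := by
  constructor
  · rintro (h | h)
    · simpa [MPset, orig, bar] using h
    · obtain ⟨o, x, _, h⟩ := hN _ h
      simp [orig, sub] at h
  · intro h
    exact Or.inl (Or.inl ⟨a, h, rfl⟩)

theorem bar_mem (P : Program A) (M : Set A) (N : Set (TA A))
    (hN : ∀ a ∈ N, ∃ o, ∃ x ∈ M, a = sub o x) (a : A) :
    bar a ∈ MPset P M ∪ N ↔ a ∈ atoms P ∧ a ∉ M := by
  constructor
  · rintro (h | h)
    · simpa [MPset, orig, bar] using h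
    · obtain ⟨o, x, _, h⟩ := hN _ h
      simp [bar, sub] at h
  · intro h
    exact Or.inl (Or.inr ⟨a, h, rfl⟩)

theorem subAtom_mem (P : Program A) (M : Set A) (N : Set (TA A)) (o : Option A) (a : A) :
    sub o a ∈ MPset P M ∪ N ↔ sub o a ∈ N := by
  constructor
  · rintro (h | h)
    · simp [MPset, orig, bar, sub] at h
    · exact h
  · exact Or.inr

theorem RX_congr (r : Rule A) (x : A) (I J : Set (TA A))
    (h : ∀ o, sub o x ∈ I ↔ sub o x ∈ J) : RX r x I ↔ RX r x J := by
  simp [RX, h]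

theorem Pprime_restrict (P : Program A) (M : Set A) (I : Set (TA A))
    (h : isModel I (Pprime P M)) :
    isModel (I ∩ {a | ∃ o, ∃ x ∈ M, a = sub o x}) (Pprime P M) := by
  rw [Pprime_iff] at h ⊢
  intro x hx hxM
  obtain ⟨h1, h2, h3⟩ := h x hx hxM
  refine ⟨fun r hr hh hN => ?_, ⟨h2, _, x, hxM, rfl⟩, fun y hy hyM =>
    ⟨h3 y hy hyM, _, x, hxM, rfl⟩⟩
  rw [RX_congr r x _ I]
  · exact h1 r hr hh hN
  · intro o
    exact ⟨fun h => h.1, fun h => ⟨h, o, x, hxM, rfl⟩⟩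

theorem min_supp (P : Program A) (M : Set A) (N : Set (TA A))
    (h : isMinModel N (Pprime P M)) : ∀ a ∈ N, ∃ o, ∃ x ∈ M, a = sub o x := by
  intro a ha
  have := h.2 _ Set.inter_subset_left (Pprime_restrict P M N h.1)
  rw [← this] at ha
  exact ha.2

/-- For `N'` supported on `M`, `M_P ∪ N'` models the reduct. -/
theorem model_of (P : Program A) (M : Set A) (hM : M ⊆ ↑(atoms P)) (N N' : Set (TA A))
    (hN : ∀ a ∈ N, ∃ o, ∃ x ∈ M, a = sub o x) (hN' : ∀ a ∈ N', ∃ o, ∃ x ∈ M, a = sub o x) :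
    isModel (MPset P M ∪ N') (reduct (Ptrans P) (MPset P M ∪ N)) ↔
      isModel N' (Pprime P M) ∧
      (∀ r ∈ P, (∀ a ∈ r.head ∪ r.bodyN, a ∉ M) → ∃ a ∈ r.bodyP, a ∉ M) ∧
      (∀ x ∈ M, sub none x ∈ N) := by
  have hRX : ∀ r x, RX r x (MPset P M ∪ N') ↔ RX r x N' :=
    fun r x => RX_congr r x _ _ (fun o => subAtom_mem P M N' o x)
  rw [Ptrans_iff, Pprime_iff]
  simp only [orig_mem P M N hN, orig_mem P M N' hN', bar_mem P M N hN, bar_mem P M N' hN',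
    subAtom_mem, hRX]
  constructor
  · rintro ⟨h1, h2, h3, h4, h5, h6, h7⟩
    refine ⟨fun x hx hxM => ⟨h5 x hx, h3 x hx (by tauto), fun y hy hyM => h4 x hx y hy (by tauto) hyM⟩,
      h6, fun x hx => ?_⟩
    by_contra hc
    exact h7 x (hM hx) hc hx
  · rintro ⟨h1, h2, h3⟩
    refine ⟨fun x hx h => by tauto, fun x hx h => ⟨hx, h⟩,
      fun x hx h => (h1 x hx (by tauto)).2.1,
      fun x hx y hy h hyM => (h1 x hx (by tauto)).2.2 y hy hyM, fun x hx r hr hh hN => ?_, h2,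
      fun x hx h hxM => h (h3 x hxM)⟩
    by_cases hxM : x ∈ M
    · exact (h1 x hx hxM).1 r hr hh hN
    · obtain ⟨y, hy⟩ := Finset.nonempty_iff_ne_empty.2 hh
      refine Or.inr (Or.inr ⟨y, hy, fun h => ?_⟩)
      obtain ⟨o, x', hx', he⟩ := hN' _ h
      simp only [sub, Sum.inr.injEq, Prod.mk.injEq] at he
      exact hxM (he.2 ▸ hx')

theorem answer_iff (P : Program A) (M : Set A) (hM : M ⊆ ↑(atoms P)) (N : Set (TA A))
    (hN : ∀ a ∈ N, ∃ o, ∃ x ∈ M, a = sub o x) :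
    isAnswerSet (MPset P M ∪ N) (Ptrans P) ↔
      isMinModel N (Pprime P M) ∧
      (∀ r ∈ P, (∀ a ∈ r.head ∪ r.bodyN, a ∉ M) → ∃ a ∈ r.bodyP, a ∉ M) ∧
      (∀ x ∈ M, sub none x ∈ N) := by
  unfold isAnswerSet
  have hdis : ∀ J : Set (TA A), (∀ a ∈ J, ∃ o, ∃ x ∈ M, a = sub o x) →
      MPset P M ∪ J = MPset P M ∪ N → J = N := by
    intro J hJ h
    ext a
    constructor
    · intro ha
      obtain ⟨o, x, hx, rfl⟩ := hJ a ha
      rw [← subAtom_mem P M N, ← h, subAtom_mem]; exact ha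
    · intro ha
      obtain ⟨o, x, hx, rfl⟩ := hN a ha
      rw [← subAtom_mem P M J, h, subAtom_mem]; exact ha
  constructor
  · rintro ⟨h1, h2⟩
    obtain ⟨h3, h4, h5⟩ := (model_of P M hM N N hN hN).1 h1
    refine ⟨⟨h3, fun J hJ hJm => ?_⟩, h4, h5⟩
    have hJs : ∀ a ∈ J, ∃ o, ∃ x ∈ M, a = sub o x := fun a ha => hN a (hJ ha)
    exact hdis J hJs (h2 _ (Set.union_subset_union_right _ hJ)
      ((model_of P M hM N J hN hJs).2 ⟨hJm, h4, h5⟩))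
  · rintro ⟨⟨h1, h2⟩, h4, h5⟩
    refine ⟨(model_of P M hM N N hN hN).2 ⟨h1, h4, h5⟩, fun J hJ hJm => ?_⟩
    have hMJ : MPset P M ⊆ J := by
      obtain ⟨g1, g2, -⟩ := (Ptrans_iff _ _ _).1 hJm
      simp only [orig_mem P M N hN, bar_mem P M N hN] at g1 g2
      rintro a (⟨x, hx, rfl⟩ | ⟨x, hx, rfl⟩)
      · exact g1 x (hM hx) (by tauto)
      · exact g2 x hx.1 hx.2
    have hJe : J = MPset P M ∪ (J ∩ N) := by
      ext a
      constructor
      · intro ha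
        rcases hJ ha with h | h
        exacts [Or.inl h, Or.inr ⟨ha, h⟩]
      · rintro (h | h)
        exacts [hMJ h, h.1]
    have hs : ∀ a ∈ J ∩ N, ∃ o, ∃ x ∈ M, a = sub o x := fun a ha => hN a ha.2
    rw [hJe] at hJm
    have := h2 _ Set.inter_subset_right ((model_of P M hM N _ hN hs).1 hJm).1
    rw [hJe, this]

theorem answer_form (P : Program A) (S : Set (TA A)) (hS : isAnswerSet S (Ptrans P)) :
    ∃ (M : Set A) (N : Set (TA A)), M ⊆ ↑(atoms P) ∧
      (∀ a ∈ N, ∃ o, ∃ x ∈ M, a = sub o x) ∧ S = MPset P M ∪ N := by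
  obtain ⟨h1, h2⟩ := hS
  obtain ⟨g1, g2, g3, g4, g5, g6, g7⟩ := (Ptrans_iff _ _ _).1 h1
  let M : Set A := {x | x ∈ atoms P ∧ bar x ∉ S}
  let N : Set (TA A) := S ∩ {a | ∃ o, ∃ x ∈ M, a = sub o x}
  let K : Set (TA A) := {a | ∃ x ∈ atoms P, (a = orig x ∧ bar x ∉ S) ∨ (a = bar x ∧ orig x ∉ S)}
  have hKo : ∀ x, orig x ∈ K ∪ N ↔ x ∈ atoms P ∧ bar x ∉ S := by
    intro x; simp [K, N, orig, bar, sub]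
  have hKb : ∀ x, bar x ∈ K ∪ N ↔ x ∈ atoms P ∧ orig x ∉ S := by
    intro x; simp [K, N, orig, bar, sub]
  have hKs : ∀ o x, sub o x ∈ K ∪ N ↔ sub o x ∈ S ∧ x ∈ atoms P ∧ bar x ∉ S := by
    intro o x; simp [K, N, M, orig, bar, sub]
  have hsub : K ∪ N ⊆ S := by
    rintro a (⟨x, hx, ⟨rfl, h⟩ | ⟨rfl, h⟩⟩ | h)
    · exact g1 x hx h
    · exact g2 x hx h
    · exact h.1
  have hKN : K ∪ N = S := by
    refine h2 _ hsub ((Ptrans_iff _ _ _).2 ⟨fun x hx h => (hKo x).2 ⟨hx, h⟩,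
      fun x hx h => (hKb x).2 ⟨hx, h⟩, fun x hx h => (hKs _ _).2 ⟨g3 x hx h, hx, h⟩,
      fun x hx y hy h h' => (hKs _ _).2 ⟨g4 x hx y hy h h', hx, h⟩, fun x hx r hr hh hN => ?_,
      fun r hr h => ?_, fun x hx h h' => g7 x hx h (hsub h')⟩)
    · by_cases hb : bar x ∈ S
      · obtain ⟨y, hy⟩ := Finset.nonempty_iff_ne_empty.2 hh
        exact Or.inr (Or.inr ⟨y, hy, fun h => ((hKs _ _).1 h).2.2 hb⟩)
      · rw [RX_congr r x _ S (fun o => by rw [hKs]; tauto)]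
        exact g5 x hx r hr hh hN
    · obtain ⟨a, ha, h⟩ := g6 r hr h
      exact ⟨a, ha, fun h' => h (hsub h')⟩
  refine ⟨M, N, fun x hx => hx.1, fun a ha => ha.2, ?_⟩
  rw [← hKN]
  congr 1
  rw [hKN] at hKo hKb
  ext a
  constructor
  · rintro ⟨x, hx, ⟨rfl, h⟩ | ⟨rfl, h⟩⟩
    · exact Or.inl ⟨x, ⟨hx, h⟩, rfl⟩
    · exact Or.inr ⟨x, ⟨hx, fun h' => h'.2 ((hKb x).2 ⟨hx, h⟩)⟩, rfl⟩
  · rintro (⟨x, ⟨hx, h⟩, rfl⟩ | ⟨x, ⟨hx, h⟩, rfl⟩)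
    · exact ⟨x, hx, Or.inl ⟨rfl, h⟩⟩
    · refine ⟨x, hx, Or.inr ⟨rfl, fun h' => h ⟨hx, ((hKo x).1 h').2⟩⟩⟩

/-- `M ∈ AS(P)` iff for every inclusion-minimal model `N` of `P'`,
`M_P ∪ N ∈ AS(P_trans)`; moreover every answer set of `P_trans` is of the form
`M_P ∪ N` for some `M ⊆ at(P)` and some inclusion-minimal model `N` of the
corresponding `P'`. -/
theorem answerSet_Ptrans_correspondence (P : Program A) (M : Set A)
    (hM : M ⊆ ↑(atoms P)) :
    (isAnswerSet M P ↔
      ∀ N : Set (TA A), isMinModel N (Pprime P M) →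
        isAnswerSet (MPset P M ∪ N) (Ptrans P)) ∧
    (∀ S : Set (TA A), isAnswerSet S (Ptrans P) →
      ∃ (M₀ : Set A) (N : Set (TA A)), M₀ ⊆ ↑(atoms P) ∧
        isMinModel N (Pprime P M₀) ∧ S = MPset P M₀ ∪ N) := by
  refine ⟨⟨fun hA N hN => ?_, fun h => ?_⟩, fun S hS => ?_⟩
  · obtain ⟨h1, h2⟩ := hA
    rw [isModel_reduct_iff] at h1
    rw [answer_iff P M hM N (min_supp P M N hN)]
    have hmod : ∀ r ∈ P, (∀ a ∈ r.head ∪ r.bodyN, a ∉ M) → ∃ a ∈ r.bodyP, a ∉ M := by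
      intro r hr h
      rcases h1 r hr (fun a ha => h a (Finset.mem_union_right _ ha)) with ⟨a, ha, h'⟩ | h'
      · exact absurd h' (h a (Finset.mem_union_left _ ha))
      · exact h'
    refine ⟨hN, hmod, fun x hx => ?_⟩
    by_contra ht
    obtain ⟨k1, k2, k3⟩ := (Pprime_iff _ _ _).1 hN.1 x (hM hx) hx
    have hJ : {y | y ∈ M ∧ sub (some y) x ∉ N} = M := by
      refine h2 _ (fun y hy => hy.1) ((isModel_reduct_iff _ _ _).2 fun r hr hn => ?_)
      by_cases hh : r.head = ∅
      · rcases h1 r hr hn with ⟨a, ha, h'⟩ | ⟨a, ha, h'⟩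
        · simp [hh] at ha
        · exact Or.inr ⟨a, ha, fun h => h' h.1⟩
      · rcases k1 r hr hh hn with h | ⟨y, hy, h⟩ | ⟨y, hy, h⟩
        · exact absurd h.2 ht
        · exact Or.inr ⟨y, hy, fun h' => h'.2 h⟩
        · refine Or.inl ⟨y, hy, ?_, h⟩
          by_contra hyM
          exact h (k3 y (mem_atoms_of hr (by simp [hy])) hyM)
    rw [← hJ] at hx
    exact hx.2 k2
  · have h' : ∀ N, isMinModel N (Pprime P M) →
        (∀ r ∈ P, (∀ a ∈ r.head ∪ r.bodyN, a ∉ M) → ∃ a ∈ r.bodyP, a ∉ M) ∧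
        (∀ x ∈ M, sub none x ∈ N) := fun N hN =>
      ((answer_iff P M hM N (min_supp P M N hN)).1 (h N hN)).2
    have key : ∀ J : Set A, J ⊆ M → ∀ x ∈ M, x ∉ J → isModel J (reduct P M) →
        isModel {a | a ≠ sub none x ∧ ∀ y ∈ J, a ≠ sub (some y) x} (Pprime P M) := by
      intro J hJ x hx hxJ hJm
      rw [isModel_reduct_iff] at hJm
      rw [Pprime_iff]
      intro z hz hzM
      by_cases hzx : z = x
      · subst hzx
        refine ⟨fun r hr hh hn => ?_, ?_, fun y hy hyM => ?_⟩
        · rcases hJm r hr hn with ⟨a, ha, haJ⟩ | ⟨a, ha, haJ⟩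
          · exact Or.inr (Or.inr ⟨a, ha, fun h => h.2 a haJ rfl⟩)
          · refine Or.inr (Or.inl ⟨a, ha, by simp [sub], fun y hy he => ?_⟩)
            simp [sub] at he
            exact haJ (he ▸ hy)
        · refine ⟨by simp [sub], fun y hy he => ?_⟩
          simp [sub] at he
          exact hxJ (he ▸ hy)
        · refine ⟨by simp [sub], fun w hw he => ?_⟩
          simp [sub] at he
          exact hyM (hJ (he ▸ hw))
      · have hall : ∀ o, (sub o z : TA A) ∈
            {a : TA A | a ≠ sub none x ∧ ∀ y ∈ J, a ≠ sub (some y) x} := by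
          intro o
          simp [sub, hzx]
        refine ⟨fun r hr hh hn => ?_, hall _, fun y hy hyM => hall _⟩
        by_cases hb : r.bodyP = ∅
        · exact Or.inl ⟨hb, hall _⟩
        · obtain ⟨y, hy⟩ := Finset.nonempty_iff_ne_empty.2 hb
          exact Or.inr (Or.inl ⟨y, hy, hall _⟩)
    constructor
    · have hu : isModel Set.univ (Pprime P M) := by
        rw [Pprime_iff]
        intro z hz hzM
        refine ⟨fun r hr hh hn => ?_, trivial, fun y hy hyM => trivial⟩
        by_cases hb : r.bodyP = ∅
        · exact Or.inl ⟨hb, trivial⟩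
        · obtain ⟨y, hy⟩ := Finset.nonempty_iff_ne_empty.2 hb
          exact Or.inr (Or.inl ⟨y, hy, trivial⟩)
      obtain ⟨N, -, hN⟩ := exists_min_model _ _ hu
      rw [isModel_reduct_iff]
      intro r hr hn
      by_cases hh : ∃ a ∈ r.head, a ∈ M
      · exact Or.inl hh
      · push Not at hh
        refine Or.inr ((h' N hN).1 r hr fun a ha => ?_)
        rcases Finset.mem_union.1 ha with ha | ha
        exacts [hh a ha, hn a ha]
    · intro J hJ hJm
      by_contra hne
      obtain ⟨x, hx, hxJ⟩ : ∃ x ∈ M, x ∉ J := by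
        by_contra hc
        push Not at hc
        exact hne (Set.Subset.antisymm hJ hc)
      obtain ⟨N, hNI, hN⟩ := exists_min_model _ _ (key J hJ x hx hxJ hJm)
      exact (hNI ((h' N hN).2 x hx)).1 rfl
  · obtain ⟨M₀, N, hM₀, hN, rfl⟩ := answer_form P S hS
    exact ⟨M₀, N, hM₀, ((answer_iff P M₀ hM₀ N hN).1 hS).1, rfl⟩
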